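/- (Passive minimax lower bound, large covariate noise, small response noise; Proposition 3.) With 𝒵 = [0,1]^{d_Z} and 𝒳 = ℝ^{d_X + 1}, in the passive setting there is a constant C > 0 depending only on L_g, s_g, L_f, s_f, d_X, d_Z such that, whenever n ≥ C σ_X^{−d_Z/s_g}, for every passive estimator f̂_{x_0} (measurable, possibly randomized, function of the i.i.d. dataset {(X_i, Y_i, Z_i)}_{i=1}^n), the supremum over all g, f, P_Z, ε_X, ε_Y satisfying the assumptions of P[ |f̂_{x_0} − f(x_0)| ≥ C (σ_X^{d_X}/n)^{s_f/(d_X + d_Z/s_g)} ] is at least 1/(2e). The supremum is over g in the global Hölder ball C^{s_g}(𝒵; 𝒳; L_g) with g(z_0) = x_0 for some z_0 around which P_Z has local dimension d_Z, f in the global Hölder ball C^{s_f}(𝒳; ℝ; L_f), distributions P_Z, sub-Gaussian ε_X with local dimension d_X around 0, and sub-Gaussian ε_Y. -/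

import Mathlib

open MeasureTheory Filter Metric

noncomputable section

/-- The local Hölder ball `C^s(Z, z₀; X; L)`: functions `g` with
`dist (g z) (g z₀) ≤ L * (dist z z₀)^s` for all `z`. -/
def LocHolderBall {Z X : Type*} [PseudoMetricSpace Z] [PseudoMetricSpace X]
    (s L : ℝ) (z0 : Z) (g : Z → X) : Prop :=
  ∀ z, dist (g z) (g z0) ≤ L * dist z z0 ^ s

/-- The global Hölder ball `C^s(Z; X; L)`. -/
def GlobHolderBall {Z X : Type*} [PseudoMetricSpace Z] [PseudoMetricSpace X]
    (s L : ℝ) (g : Z → X) : Prop :=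
  ∀ z z', dist (g z) (g z') ≤ L * dist z z' ^ s

/-- A measure `P` on a metric space has local dimension `d` around `x`:
`liminf_{r↓0} P(closedBall x r)/r^d > 0`. -/
def HasLocalDim {X : Type*} [PseudoMetricSpace X] [MeasurableSpace X]
    (P : Measure X) (x : X) (d : ℝ) : Prop :=
  0 < liminf (fun r : ℝ => (P (closedBall x r)).toReal / r ^ d) (nhdsWithin 0 (Set.Ioi 0))

/-- A random variable `V` on `(Ω, μ)` has local dimension `d` around `x`. -/
def RVHasLocalDim {Ω X : Type*} [MeasurableSpace Ω] [PseudoMetricSpace X]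
    (μ : Measure Ω) (V : Ω → X) (x : X) (d : ℝ) : Prop :=
  0 < liminf (fun r : ℝ => (μ {ω | dist (V ω) x ≤ r}).toReal / r ^ d)
      (nhdsWithin 0 (Set.Ioi 0))

/-- A probability distribution on `ℝ^d` is sub-Gaussian:
`E[exp⟨x, t⟩] ≤ exp(‖t‖₂²/2)` for all `t`. -/
def SubGaussianVec {d : ℕ} (P : Measure (Fin d → ℝ)) : Prop :=
  ∀ t : Fin d → ℝ, ∫ x, Real.exp (∑ j, x j * t j) ∂P ≤ Real.exp ((∑ j, t j ^ 2) / 2)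

/-- A probability distribution on `ℝ` is sub-Gaussian. -/
def SubGaussianReal (P : Measure ℝ) : Prop :=
  ∀ t : ℝ, ∫ x, Real.exp (x * t) ∂P ≤ Real.exp (t ^ 2 / 2)

/-- `v` is a possible value of the `k`-nearest-neighbor regressor of the data
`(X i, Y i)` at the point `x0`: there is an enumeration of the data ordered by
increasing distance of `X i` to `x0` (ties broken arbitrarily), and `v` is the
average of the responses `Y i` over the first `k` data points. -/
def IsKNNValue {ι : Type*} [Fintype ι] {dX : ℕ} (k : ℕ) (x0 : Fin dX → ℝ)
    (X : ι → Fin dX → ℝ) (Y : ι → ℝ) (v : ℝ) : Prop :=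
  ∃ e : ι ≃ Fin (Fintype.card ι),
    (∀ i j : ι, e i ≤ e j → dist (X i) x0 ≤ dist (X j) x0) ∧
    v = (k : ℝ)⁻¹ * ∑ i : ι, if ((e i : ℕ) < k) then Y i else 0

/-- The cube `[0,1]^m` with the sup metric. -/
abbrev Cube (m : ℕ) := Fin m → Set.Icc (0:ℝ) 1

/-- The standard `d`-dimensional bump function
`K_d(x) = exp(1 - 1/(1 - ‖x‖₂²)) 1{‖x‖₂ < 1}`. -/
def bumpFn (d : ℕ) (x : Fin d → ℝ) : ℝ :=
  if (∑ j, x j ^ 2) < 1 then Real.exp (1 - 1 / (1 - ∑ j, x j ^ 2)) else 0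

/-- The Hölder seminorm `‖f‖_{C^s} = sup_{z ≠ z'} dist (f z) (f z') / dist z z' ^ s`. -/
def holderSeminorm {Z X : Type*} [PseudoMetricSpace Z] [PseudoMetricSpace X]
    (s : ℝ) (f : Z → X) : ℝ :=
  ⨆ p : Z × Z, if dist p.1 p.2 = 0 then 0 else dist (f p.1) (f p.2) / dist p.1 p.2 ^ s

/-- A measure whose small balls around `x` have mass exactly `r ^ d` has local dimension `d`. -/
lemma hasLocalDim_of_measure_closedBall {X : Type*} [PseudoMetricSpace X] [MeasurableSpace X]
    {P : Measure X} {x : X} {d : ℕ}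
    (h : ∀ r : ℝ, 0 < r → r ≤ 1 → P (closedBall x r) = ENNReal.ofReal r ^ d) :
    HasLocalDim P x (d : ℝ) := by
  have hev : ∀ᶠ r : ℝ in nhdsWithin 0 (Set.Ioi 0),
      (P (closedBall x r)).toReal / r ^ (d : ℝ) = 1 := by
    filter_upwards [Ioc_mem_nhdsGT (zero_lt_one : (0 : ℝ) < 1)] with r hr
    rw [h r hr.1 hr.2, ENNReal.toReal_pow, ENNReal.toReal_ofReal hr.1.le, Real.rpow_natCast]
    exact div_self (pow_pos hr.1 d).ne'
  rw [HasLocalDim, liminf_congr hev, liminf_const]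
  exact one_pos

/-- The uniform distribution on `[-1, 1]`. -/
def unifSymm : Measure ℝ := (2⁻¹ : ENNReal) • volume.restrict (Set.Icc (-1) 1)

instance : IsProbabilityMeasure unifSymm where
  measure_univ := by
    have h2 : ENNReal.ofReal (1 - -1) = 2 := by norm_num
    simp only [unifSymm, Measure.smul_apply, Measure.restrict_apply MeasurableSet.univ,
      Set.univ_inter, Real.volume_Icc, h2, smul_eq_mul]
    exact ENNReal.inv_mul_cancel two_ne_zero ENNReal.ofNat_ne_top

lemma inv_two_mul_ofReal (s : ℝ) : (2⁻¹ : ENNReal) * ENNReal.ofReal (2 * s) = ENNReal.ofReal s := by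
  rw [ENNReal.ofReal_mul zero_le_two, ENNReal.ofReal_ofNat, ← mul_assoc,
    ENNReal.inv_mul_cancel two_ne_zero ENNReal.ofNat_ne_top, one_mul]

lemma unifSymm_closedBall_le (s : ℝ) : unifSymm (closedBall 0 s) ≤ ENNReal.ofReal s := by
  rw [← inv_two_mul_ofReal s, ← Real.volume_closedBall 0 s, unifSymm, Measure.smul_apply,
    smul_eq_mul]
  gcongr
  exact Measure.restrict_le_self

lemma unifSymm_closedBall {s : ℝ} (hs : s ≤ 1) :
    unifSymm (closedBall 0 s) = ENNReal.ofReal s := by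
  rw [unifSymm, Measure.smul_apply, smul_eq_mul, Measure.restrict_eq_self, Real.volume_closedBall,
    inv_two_mul_ofReal]
  rw [Real.closedBall_eq_Icc, zero_sub, zero_add]
  exact Set.Icc_subset_Icc (neg_le_neg hs) hs

lemma integral_unifSymm : ∫ x, x ∂unifSymm = 0 := by
  rw [unifSymm, integral_smul_measure, integral_Icc_eq_integral_Ioc,
    ← intervalIntegral.integral_of_le (by norm_num), integral_id]
  norm_num

lemma subGaussianReal_unifSymm : SubGaussianReal unifSymm := by
  intro t
  have hmem : ∀ᵐ x ∂unifSymm, id x ∈ Set.Icc (-1 : ℝ) 1 :=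
    Measure.ae_smul_measure (ae_restrict_mem measurableSet_Icc) _
  have h := (ProbabilityTheory.hasSubgaussianMGF_of_mem_Icc_of_integral_eq_zero
    aemeasurable_id hmem integral_unifSymm).mgf_le t
  have hc : (((‖(1 : ℝ) - -1‖₊ / 2) ^ 2 : NNReal) : ℝ) = 1 := by
    push_cast
    norm_num
  rw [hc, one_mul] at h
  simpa [ProbabilityTheory.mgf, mul_comm] using h

lemma subGaussianReal_dirac_zero : SubGaussianReal (Measure.dirac 0) := by
  intro t
  simp only [integral_dirac, zero_mul, Real.exp_zero]
  exact Real.one_le_exp (by positivity)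

/-- Product measures with sub-Gaussian marginals are sub-Gaussian. -/
lemma SubGaussianVec.pi {d : ℕ} {μ : Fin d → Measure ℝ} [∀ i, SigmaFinite (μ i)]
    (h : ∀ i, SubGaussianReal (μ i)) : SubGaussianVec (Measure.pi μ) := by
  intro t
  simp_rw [Real.exp_sum]
  rw [integral_fintype_prod_eq_prod (fun i x => Real.exp (x * t i)), Finset.sum_div, Real.exp_sum]
  exact Finset.prod_le_prod (fun i _ => integral_nonneg fun x => (Real.exp_pos _).le)
    fun i _ => h i (t i)

/-- The marginals of a noise vector that vanishes in the first coordinate and is uniform in the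
remaining ones. -/
def degenMarginal {d : ℕ} : Fin (d + 1) → Measure ℝ :=
  Fin.cons (Measure.dirac 0) fun _ => unifSymm

instance {d : ℕ} (i : Fin (d + 1)) : IsProbabilityMeasure (degenMarginal i) := by
  refine Fin.cases ?_ (fun j => ?_) i
  · simp only [degenMarginal, Fin.cons_zero]
    infer_instance
  · simp only [degenMarginal, Fin.cons_succ]
    infer_instance

lemma pi_degenMarginal_closedBall {d : ℕ} {s : ℝ} (hs : 0 ≤ s) :
    Measure.pi (degenMarginal (d := d)) (closedBall 0 s) = unifSymm (closedBall 0 s) ^ d := by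
  rw [closedBall_pi _ hs, Measure.pi_pi, Fin.prod_univ_succ]
  simp [degenMarginal, Measure.dirac_apply_of_mem, hs]

lemma subGaussianReal_degenMarginal {d : ℕ} (i : Fin (d + 1)) :
    SubGaussianReal (degenMarginal i) := by
  refine Fin.cases ?_ (fun j => ?_) i
  · simpa only [degenMarginal, Fin.cons_zero] using subGaussianReal_dirac_zero
  · simpa only [degenMarginal, Fin.cons_succ] using subGaussianReal_unifSymm

lemma integral_degenMarginal {d : ℕ} (i : Fin (d + 1)) : ∫ x, x ∂(degenMarginal i) = 0 := by
  refine Fin.cases ?_ (fun j => ?_) i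
  · simp [degenMarginal]
  · simpa only [degenMarginal, Fin.cons_succ] using integral_unifSymm

lemma unitInterval_closedBall_zero (s : ℝ) :
    (closedBall (0 : Set.Icc (0 : ℝ) 1) s) = Subtype.val ⁻¹' Set.Iic s := by
  ext z
  simp [Subtype.dist_eq, abs_of_nonneg z.2.1]

lemma volume_cube_closedBall_le {m : ℕ} {s : ℝ} (hs : 0 ≤ s) :
    volume (closedBall (0 : Cube m) s) ≤ ENNReal.ofReal s ^ m := by
  rw [closedBall_pi _ hs, volume_pi, Measure.pi_pi]
  calc _ ≤ ∏ _i : Fin m, ENNReal.ofReal s := by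
        gcongr with i
        simp only [Pi.zero_apply]
        rw [unitInterval_closedBall_zero, unitInterval.volume_apply]
        refine (measure_mono (t := Set.Icc 0 s) ?_).trans (by simp)
        rintro _ ⟨z, hz, rfl⟩
        exact ⟨z.2.1, hz⟩
    _ = _ := by simp

lemma volume_cube_closedBall {m : ℕ} {s : ℝ} (hs : 0 < s) (hs1 : s ≤ 1) :
    volume (closedBall (0 : Cube m) s) = ENNReal.ofReal s ^ m := by
  rw [closedBall_pi _ hs.le, volume_pi, Measure.pi_pi]
  have h : ∀ i : Fin m, volume (closedBall ((0 : Cube m) i) s) = ENNReal.ofReal s := fun i => by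
    have : closedBall (0 : Set.Icc (0 : ℝ) 1) s = Set.Iic ⟨s, hs.le, hs1⟩ := by
      rw [unitInterval_closedBall_zero]
      rfl
    simp only [Pi.zero_apply]
    rw [this, unitInterval.volume_Iic]
  rw [Finset.prod_congr rfl fun i _ => h i, Finset.prod_const, Finset.card_univ, Fintype.card_fin]

lemma abs_rpow_sub_rpow_le {s a b : ℝ} (hs0 : 0 ≤ s) (hs1 : s ≤ 1) (ha : 0 ≤ a) (hb : 0 ≤ b) :
    |a ^ s - b ^ s| ≤ |a - b| ^ s := by
  wlog hab : b ≤ a generalizing a b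
  · rw [abs_sub_comm, abs_sub_comm a]
    exact this hb ha (le_of_not_ge hab)
  have h := Real.rpow_add_le_add_rpow (sub_nonneg.2 hab) hb hs0 hs1
  rw [sub_add_cancel] at h
  rw [abs_of_nonneg (sub_nonneg.2 hab),
    abs_of_nonneg (sub_nonneg.2 (Real.rpow_le_rpow hb hab hs0))]
  linarith

lemma abs_dist_rpow_sub_le {Z : Type*} [PseudoMetricSpace Z] {s : ℝ} (hs0 : 0 ≤ s) (hs1 : s ≤ 1)
    (x y z : Z) : |dist x z ^ s - dist y z ^ s| ≤ dist x y ^ s :=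
  (abs_rpow_sub_rpow_le hs0 hs1 dist_nonneg dist_nonneg).trans
    (Real.rpow_le_rpow (abs_nonneg _) (abs_dist_sub_le x y z) hs0)

/-- The map `z ↦ x0 + L |z|^s e₀`. -/
def cuspMap {m d : ℕ} (s L : ℝ) (x0 : Fin (d + 1) → ℝ) (z : Cube m) : Fin (d + 1) → ℝ :=
  x0 + Fin.cons (L * dist z 0 ^ s) 0

lemma cuspMap_zero {m d : ℕ} {s : ℝ} (hs : 0 < s) (L : ℝ) (x0 : Fin (d + 1) → ℝ) :
    cuspMap s L x0 (0 : Cube m) = x0 := by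
  funext j
  refine Fin.cases ?_ (fun j => ?_) j <;> simp [cuspMap, Real.zero_rpow hs.ne']

lemma globHolderBall_cuspMap {m d : ℕ} {s L : ℝ} (hs0 : 0 ≤ s) (hs1 : s ≤ 1) (hL : 0 ≤ L)
    (x0 : Fin (d + 1) → ℝ) : GlobHolderBall s L (cuspMap (m := m) s L x0) := by
  intro z z'
  refine (dist_pi_le_iff (by positivity)).2 fun j => Fin.cases ?_ (fun j => ?_) j
  · have h := mul_le_mul_of_nonneg_left (abs_dist_rpow_sub_le hs0 hs1 z z' 0) hL
    rw [← abs_of_nonneg hL, ← abs_mul, abs_of_nonneg hL, mul_sub] at h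
    simpa [cuspMap, Real.dist_eq] using h
  · simp only [cuspMap, Pi.add_apply, Fin.cons_succ, Pi.zero_apply, dist_self]
    positivity

/-- The bump `L (r^s - |x - x0|^s)₊`. -/
def holderBump {X : Type*} [PseudoMetricSpace X] (s L r : ℝ) (x0 x : X) : ℝ :=
  L * max 0 (r ^ s - dist x x0 ^ s)

lemma globHolderBall_holderBump {X : Type*} [PseudoMetricSpace X] {s L : ℝ} (hs0 : 0 ≤ s)
    (hs1 : s ≤ 1) (hL : 0 ≤ L) (r : ℝ) (x0 : X) : GlobHolderBall s L (holderBump s L r x0) := by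
  intro x y
  rw [holderBump, holderBump, Real.dist_eq, ← mul_sub, abs_mul, abs_of_nonneg hL]
  refine mul_le_mul_of_nonneg_left ?_ hL
  refine (abs_max_sub_max_le_max _ _ _ _).trans (max_le (by simp; positivity) ?_)
  rw [sub_sub_sub_cancel_left, abs_sub_comm]
  exact abs_dist_rpow_sub_le hs0 hs1 x y x0

lemma holderBump_self {X : Type*} [PseudoMetricSpace X] {s r : ℝ} (hs : 0 < s) (hr : 0 ≤ r)
    (L : ℝ) (x0 : X) : holderBump s L r x0 x0 = L * r ^ s := by
  simp [holderBump, Real.zero_rpow hs.ne', Real.rpow_nonneg hr]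

lemma holderBump_eq_zero {X : Type*} [PseudoMetricSpace X] {s L r : ℝ} (hs : 0 ≤ s) (hr : 0 ≤ r)
    {x0 x : X} (h : r ≤ dist x x0) : holderBump s L r x0 x = 0 := by
  rw [holderBump, max_eq_left (sub_nonpos.2 (Real.rpow_le_rpow hr h hs)), mul_zero]

/-- If the noisy image of a latent point under `cuspMap` lies in the ball of radius `r` around
`x0`, then the latent point and the noise lie in small balls around the origin. -/
lemma mem_closedBall_of_dist_cuspMap_le {m d : ℕ} {s L σ r : ℝ} (hs : 0 < s) (hL : 0 < L)
    (hσ : 0 < σ) (hr : 0 ≤ r) {x0 e : Fin (d + 1) → ℝ} {z : Cube m} (he : e 0 = 0)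
    (h : dist (cuspMap s L x0 z + σ • e) x0 ≤ r) :
    z ∈ closedBall (0 : Cube m) ((r / L) ^ (1 / s)) ∧ e ∈ closedBall 0 (r / σ) := by
  rw [dist_pi_le_iff hr] at h
  constructor
  · have h0 := h 0
    simp only [cuspMap, Pi.add_apply, Fin.cons_zero, Pi.smul_apply, he, smul_zero, add_zero,
      Real.dist_eq, add_sub_cancel_left] at h0
    have h1 : dist z 0 ^ s ≤ r / L := by
      rw [le_div_iff₀' hL]
      exact (le_abs_self _).trans h0
    rw [mem_closedBall, one_div]
    exact (Real.le_rpow_inv_iff_of_pos dist_nonneg (by positivity) hs).2 h1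
  · rw [mem_closedBall, dist_pi_le_iff (by positivity)]
    refine fun j => Fin.cases ?_ (fun j => ?_) j
    · simp only [he, Pi.zero_apply, dist_self]
      positivity
    · have hj := h j.succ
      simp only [cuspMap, Pi.add_apply, Fin.cons_succ, Pi.zero_apply, add_zero, Pi.smul_apply,
        smul_eq_mul, Real.dist_eq, add_sub_cancel_left, abs_mul, abs_of_pos hσ] at hj
      rw [Pi.zero_apply, Real.dist_eq, sub_zero, le_div_iff₀' hσ]
      exact hj

/-- Probability that an i.i.d. sample of size `n` avoids a set of mass at most `1 / (2n)`. -/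
lemma half_le_measure_pi_compl {Ω : Type*} [MeasurableSpace Ω] {μ : Measure Ω}
    [IsProbabilityMeasure μ] {n : ℕ} (hn : 0 < n) {B : Set Ω} (hB : (μ B).toReal ≤ 1 / (2 * n)) :
    1 / 2 ≤ ((Measure.pi fun _ : Fin n => μ) (Set.univ.pi fun _ => Bᶜ)).toReal := by
  have hn' : (1 : ℝ) ≤ n := by exact_mod_cast hn
  have h1 : 1 ≤ (μ B).toReal + (μ Bᶜ).toReal := by
    have := measureReal_union_le (μ := μ) B Bᶜ
    rwa [Set.union_compl_self, probReal_univ] at this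
  rw [Measure.pi_pi, Finset.prod_const, Finset.card_univ, Fintype.card_fin, ENNReal.toReal_pow]
  have h2 : (1 : ℝ) / (2 * n) ≤ 1 := by
    rw [div_le_one (by positivity)]
    linarith
  calc (1 : ℝ) / 2 = 1 + n * (-(1 / (2 * n))) := by field_simp; norm_num
    _ ≤ (1 + -(1 / (2 * n))) ^ n := one_add_mul_le_pow (by linarith) n
    _ ≤ _ := pow_le_pow_left₀ (by linarith) (by linarith) n

/-- Le Cam's two-point argument for hypotheses that are indistinguishable on a set `G`. -/
lemma exists_quarter_le_of_indistinguishable {Ω : Type*} [MeasurableSpace Ω] {μ : Measure Ω}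
    [IsProbabilityMeasure μ] {G : Set Ω} (hG : 1 / 2 ≤ (μ G).toReal) {T₀ T₁ : Ω → ℝ}
    (hT : ∀ ω ∈ G, T₀ ω = T₁ ω) {a₀ a₁ b : ℝ} (hb : 2 * b ≤ |a₀ - a₁|) :
    1 / 4 ≤ (μ {ω | b ≤ |T₀ ω - a₀|}).toReal ∨ 1 / 4 ≤ (μ {ω | b ≤ |T₁ ω - a₁|}).toReal := by
  by_contra! h
  have hsub : G ⊆ {ω | b ≤ |T₀ ω - a₀|} ∪ {ω | b ≤ |T₁ ω - a₁|} := by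
    intro ω hω
    by_contra hc
    simp only [Set.mem_union, Set.mem_ofPred_eq, not_or, not_le] at hc
    rw [hT ω hω] at hc
    have := abs_sub_le a₀ (T₁ ω) a₁
    rw [abs_sub_comm a₀ (T₁ ω)] at this
    linarith [hc.1, hc.2]
  have h1 : (μ G).toReal ≤ _ := measureReal_mono (μ := μ) hsub
  have h2 := measureReal_union_le (μ := μ) {ω | b ≤ |T₀ ω - a₀|} {ω | b ≤ |T₁ ω - a₁|}
  simp only [measureReal_def] at h1 h2
  linarith [h.1, h.2]

lemma ae_degenMarginal_apply_zero {d : ℕ} :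
    ∀ᵐ e ∂Measure.pi (degenMarginal (d := d)), e 0 = 0 := by
  have h : ∀ᵐ x ∂degenMarginal (0 : Fin (d + 1)), x = 0 := by
    simp [degenMarginal, ae_dirac_eq]
  exact (measurePreserving_eval degenMarginal 0).quasiMeasurePreserving.ae h

/-- Probability that a covariate of the model with link `cuspMap` falls within `r` of `x0`. -/
lemma measure_dist_cuspMap_le {dX dZ : ℕ} {s L σ r : ℝ} (hs : 0 < s) (hL : 0 < L) (hσ : 0 < σ)
    (hr : 0 < r) (x0 : Fin (dX + 1) → ℝ) :
    (((volume : Measure (Cube dZ)).prod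
        ((Measure.pi (degenMarginal (d := dX))).prod (Measure.dirac (0 : ℝ))))
      {w | dist (cuspMap s L x0 w.1 + σ • w.2.1) x0 ≤ r}).toReal ≤
      r ^ ((dX : ℝ) + dZ / s) / (L ^ ((dZ : ℝ) / s) * σ ^ (dX : ℝ)) := by
  have hz : 0 ≤ (r / L) ^ (1 / s) := by positivity
  have he : 0 ≤ r / σ := by positivity
  have hle : ((volume : Measure (Cube dZ)).prod
        ((Measure.pi (degenMarginal (d := dX))).prod (Measure.dirac (0 : ℝ))))
      {w | dist (cuspMap s L x0 w.1 + σ • w.2.1) x0 ≤ r} ≤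
      ENNReal.ofReal ((r / L) ^ (1 / s)) ^ dZ * ENNReal.ofReal (r / σ) ^ dX := calc
    _ ≤ ((volume : Measure (Cube dZ)).prod
          ((Measure.pi (degenMarginal (d := dX))).prod (Measure.dirac (0 : ℝ))))
        (closedBall 0 ((r / L) ^ (1 / s)) ×ˢ (closedBall 0 (r / σ) ×ˢ Set.univ)) := by
      refine measure_mono_ae ?_
      have h1 : ∀ᵐ v ∂(Measure.pi (degenMarginal (d := dX))).prod (Measure.dirac (0 : ℝ)),
          v.1 0 = 0 :=
        Measure.quasiMeasurePreserving_fst.ae ae_degenMarginal_apply_zero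
      have h0 : ∀ᵐ w ∂(volume : Measure (Cube dZ)).prod
          ((Measure.pi (degenMarginal (d := dX))).prod (Measure.dirac (0 : ℝ))), w.2.1 0 = 0 :=
        Measure.quasiMeasurePreserving_snd.ae h1
      filter_upwards [h0] with w hw hdist
      have := mem_closedBall_of_dist_cuspMap_le hs hL hσ hr.le hw hdist
      exact ⟨this.1, this.2, Set.mem_univ _⟩
    _ = volume (closedBall (0 : Cube dZ) ((r / L) ^ (1 / s))) *
        unifSymm (closedBall 0 (r / σ)) ^ dX := by
      rw [Measure.prod_prod, Measure.prod_prod, measure_univ, mul_one,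
        pi_degenMarginal_closedBall he]
    _ ≤ _ := by
      gcongr
      · exact volume_cube_closedBall_le hz
      · exact unifSymm_closedBall_le _
  refine (ENNReal.toReal_mono (by finiteness) hle).trans (le_of_eq ?_)
  rw [ENNReal.toReal_mul, ENNReal.toReal_pow, ENNReal.toReal_pow, ENNReal.toReal_ofReal hz,
    ENNReal.toReal_ofReal he, ← Real.rpow_natCast, ← Real.rpow_natCast, ← Real.rpow_mul
    (by positivity), one_div_mul_eq_div, Real.div_rpow hr.le hL.le, Real.div_rpow hr.le hσ.le,
    Real.rpow_add hr]
  field_simp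

/-- **Proposition 3 (Passive minimax lower bound, large covariate noise, small response
noise).** Here the covariate space is `𝒳 = ℝ^{d_X + 1}`, while the covariate noise has
local dimension `d_X` around `0`. -/
theorem passive_lower_bound_no_response_noise
    (sg sf Lg Lf : ℝ) (dX dZ : ℕ)
    (hsg : sg ∈ Set.Ioc (0:ℝ) 1) (hsf : sf ∈ Set.Ioc (0:ℝ) 1)
    (hLg : 0 < Lg) (hLf : 0 < Lf) (hdX : 0 < dX) (hdZ : 0 < dZ) :
    ∃ C : ℝ, 0 < C ∧
      ∀ (n : ℕ) (σX σY : ℝ), 0 < σX → 0 ≤ σY →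
      C * σX ^ (-(dZ : ℝ) / sg) ≤ (n : ℝ) →
      ∀ x0 : Fin (dX + 1) → ℝ,
      ∀ (U : Type) [MeasurableSpace U] (PU : Measure U) [IsProbabilityMeasure PU]
        (fhat : (Fin n → Cube dZ × (Fin (dX + 1) → ℝ) × ℝ) → U → ℝ),
        Measurable
          (fun p : (Fin n → Cube dZ × (Fin (dX + 1) → ℝ) × ℝ) × U => fhat p.1 p.2) →
      ∃ (g : Cube dZ → Fin (dX + 1) → ℝ) (f : (Fin (dX + 1) → ℝ) → ℝ)
        (PZ : Measure (Cube dZ)) (PeX : Measure (Fin (dX + 1) → ℝ)) (PeY : Measure ℝ),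
        IsProbabilityMeasure PZ ∧ IsProbabilityMeasure PeX ∧ IsProbabilityMeasure PeY ∧
        GlobHolderBall sg Lg g ∧ GlobHolderBall sf Lf f ∧
        (∃ z0 : Cube dZ, g z0 = x0 ∧ HasLocalDim PZ z0 (dZ : ℝ)) ∧
        HasLocalDim PeX 0 (dX : ℝ) ∧
        SubGaussianVec PeX ∧ SubGaussianReal PeY ∧
        (∀ j, ∫ x, x j ∂PeX = 0) ∧ (∫ y, y ∂PeY = 0) ∧
        1 / (2 * Real.exp 1) ≤
          (((Measure.pi fun _ : Fin n => PZ.prod (PeX.prod PeY)).prod PU)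
            {p | C * (σX ^ (dX : ℝ) / n) ^ (sf / ((dX : ℝ) + (dZ : ℝ) / sg)) ≤
              |fhat (fun i =>
                  ((p.1 i).1,
                    g ((p.1 i).1) + σX • (p.1 i).2.1,
                    f (g ((p.1 i).1) + σX • (p.1 i).2.1) + σY * (p.1 i).2.2)) p.2
                - f x0|}).toReal := by
  obtain ⟨hsg0, hsg1⟩ := hsg
  obtain ⟨hsf0, hsf1⟩ := hsf
  set D : ℝ := (dX : ℝ) + (dZ : ℝ) / sg with hD
  have hDpos : 0 < D := by positivity
  set c : ℝ := (Lg ^ ((dZ : ℝ) / sg) / 2) ^ (1 / D) with hc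
  have hcpos : 0 < c := by positivity
  refine ⟨Lf * c ^ sf / 2, by positivity, ?_⟩
  intro n σX σY hσX _ hn x0 U _ PU _ fhat _
  have hnpos : (0 : ℝ) < n := lt_of_lt_of_le (by positivity) hn
  set ρ : ℝ := σX ^ (dX : ℝ) / n with hρ
  have hρpos : 0 < ρ := by positivity
  set r : ℝ := c * ρ ^ (1 / D) with hr
  have hrpos : 0 < r := by positivity
  have hrsf : r ^ sf = c ^ sf * ρ ^ (sf / D) := by
    rw [hr, Real.mul_rpow hcpos.le (by positivity), ← Real.rpow_mul hρpos.le, one_div_mul_eq_div]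
  have hrD : r ^ D = Lg ^ ((dZ : ℝ) / sg) / 2 * ρ := by
    rw [hr, hc, ← Real.mul_rpow (by positivity) hρpos.le, ← Real.rpow_mul (by positivity),
      one_div_mul_cancel hDpos.ne', Real.rpow_one]
  have hhit := measure_dist_cuspMap_le (dZ := dZ) hsg0 hLg hσX hrpos x0
  rw [← hD, hrD] at hhit
  have hrate : Lg ^ ((dZ : ℝ) / sg) / 2 * ρ / (Lg ^ ((dZ : ℝ) / sg) * σX ^ (dX : ℝ)) =
      1 / (2 * n) := by
    rw [hρ]
    field_simp
  rw [hrate] at hhit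
  set B : Set (Cube dZ × (Fin (dX + 1) → ℝ) × ℝ) :=
    {w | dist (cuspMap sg Lg x0 w.1 + σX • w.2.1) x0 ≤ r} with hB
  set μ : Measure (Cube dZ × (Fin (dX + 1) → ℝ) × ℝ) :=
    (volume : Measure (Cube dZ)).prod
      ((Measure.pi (degenMarginal (d := dX))).prod (Measure.dirac (0 : ℝ))) with hμ
  have hgood : 1 / 2 ≤ (((Measure.pi fun _ : Fin n => μ).prod PU)
      ((Set.univ.pi fun _ => Bᶜ) ×ˢ Set.univ)).toReal := by
    rw [Measure.prod_prod, measure_univ, mul_one]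
    exact half_le_measure_pi_compl (by exact_mod_cast hnpos) hhit
  let est (f : (Fin (dX + 1) → ℝ) → ℝ)
      (p : (Fin n → Cube dZ × (Fin (dX + 1) → ℝ) × ℝ) × U) : ℝ :=
    fhat (fun i => ((p.1 i).1, cuspMap sg Lg x0 (p.1 i).1 + σX • (p.1 i).2.1,
      f (cuspMap sg Lg x0 (p.1 i).1 + σX • (p.1 i).2.1) + σY * (p.1 i).2.2)) p.2
  have hest : ∀ p ∈ (Set.univ.pi fun _ : Fin n => Bᶜ) ×ˢ (Set.univ : Set U),
      est (holderBump sf Lf r x0) p = est 0 p := by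
    intro p hp
    have hfar : ∀ i, holderBump sf Lf r x0
        (cuspMap sg Lg x0 (p.1 i).1 + σX • (p.1 i).2.1) = 0 := fun i =>
      holderBump_eq_zero hsf0.le hrpos.le (le_of_not_ge (hp.1 i (Set.mem_univ i) : p.1 i ∉ B))
    simp only [est, hfar, Pi.zero_apply]
  have hsep : 2 * (Lf * c ^ sf / 2 * ρ ^ (sf / D)) ≤
      |holderBump sf Lf r x0 x0 - (0 : (Fin (dX + 1) → ℝ) → ℝ) x0| := by
    rw [holderBump_self hsf0 hrpos.le, hrsf, Pi.zero_apply, sub_zero]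
    refine le_trans (le_of_eq ?_) (le_abs_self _)
    ring
  have hquarter : 1 / (2 * Real.exp 1) ≤ 1 / 4 := by
    have := Real.exp_one_gt_d9
    exact one_div_le_one_div_of_le (by norm_num) (by linarith)
  have hmodel : ∃ f : (Fin (dX + 1) → ℝ) → ℝ, GlobHolderBall sf Lf f ∧
      1 / 4 ≤ (((Measure.pi fun _ : Fin n => μ).prod PU)
        {p | Lf * c ^ sf / 2 * ρ ^ (sf / D) ≤ |est f p - f x0|}).toReal := by
    rcases exists_quarter_le_of_indistinguishable hgood hest hsep with h | h
    · exact ⟨_, globHolderBall_holderBump hsf0.le hsf1 hLf.le r x0, h⟩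
    · refine ⟨0, fun x y => ?_, h⟩
      simp only [Pi.zero_apply, dist_self]
      positivity
  obtain ⟨f, hf, hprob⟩ := hmodel
  refine ⟨cuspMap sg Lg x0, f, volume, Measure.pi degenMarginal, Measure.dirac 0, inferInstance,
    inferInstance, inferInstance, globHolderBall_cuspMap hsg0.le hsg1 hLg.le x0, hf,
    ⟨0, cuspMap_zero hsg0 Lg x0, hasLocalDim_of_measure_closedBall fun _ => volume_cube_closedBall⟩,
    hasLocalDim_of_measure_closedBall fun s hs0 hs1 => ?_,
    SubGaussianVec.pi subGaussianReal_degenMarginal, subGaussianReal_dirac_zero, fun j => ?_, ?_,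
    hquarter.trans hprob⟩
  · rw [pi_degenMarginal_closedBall hs0.le, unifSymm_closedBall hs1]
  · have h := integral_comp_eval (μ := degenMarginal (d := dX)) (i := j) (f := fun x : ℝ => x)
      aestronglyMeasurable_id
    exact h.trans (integral_degenMarginal j)
  · simp

end
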